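/- arXiv:1705.02220 — 7 statements merged into one kernel-verified Lean document; each statement's English description precedes it below -/
import Mathlib

section
/- Let d : Fin m → ℤ and e : Fin n → ℤ be dice, let i : Fin m, set v = d i, and let v' ≥ v be an integer such that no face value of e lies in the closed interval [v, v']. Let d' be the die obtained from d by changing face i to the value v'. Then wins(d', e) = wins(d, e), wins(e, d') = wins(e, d), and ties(d', e) = ties(d, e); in particular d' beats e if and only if d beats e. (This is the paper's claim that a face pattern '<N=N' may be replaced by '<N<N' without affecting the nontransitive characteristic.) -/
/-- Number of (face, face) pairs where die `d` shows a strictly higher value than die `e`. -/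
def wins {α β : Type*} [Fintype α] [Fintype β] (d : α → ℤ) (e : β → ℤ) : ℕ :=
  (Finset.univ.filter (fun p : α × β => e p.2 < d p.1)).card

/-- Number of (face, face) pairs where dice `d` and `e` show equal values. -/
def ties {α β : Type*} [Fintype α] [Fintype β] (d : α → ℤ) (e : β → ℤ) : ℕ :=
  (Finset.univ.filter (fun p : α × β => d p.1 = e p.2)).card

/-- Die `d` beats die `e` if `d` wins against `e` more often than `e` wins against `d`. -/
def Beats {α β : Type*} [Fintype α] [Fintype β] (d : α → ℤ) (e : β → ℤ) : Prop :=
  wins e d < wins d e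

instance {α β : Type*} [Fintype α] [Fintype β] (d : α → ℤ) (e : β → ℤ) :
    Decidable (Beats d e) := Nat.decLt _ _

/-- A triple of dice is nontransitive if A beats B, B beats C, and C beats A. -/
def Nontransitive {α : Type*} [Fintype α] (A B C : α → ℤ) : Prop :=
  Beats A B ∧ Beats B C ∧ Beats C A

theorem update_lt_iff_of_gap {ι κ : Type*} [DecidableEq ι] {d : ι → ℤ} {e : κ → ℤ} {i : ι}
    {v' : ℤ} (hv : d i ≤ v') (hgap : ∀ j, ¬ (d i ≤ e j ∧ e j ≤ v')) (a : ι) (b : κ) :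
    e b < Function.update d i v' a ↔ e b < d a := by
  have := hgap b
  rcases eq_or_ne a i with rfl | ha
  · rw [Function.update_self]
    omega
  · rw [Function.update_of_ne ha]

theorem lt_update_iff_of_gap {ι κ : Type*} [DecidableEq ι] {d : ι → ℤ} {e : κ → ℤ} {i : ι}
    {v' : ℤ} (hv : d i ≤ v') (hgap : ∀ j, ¬ (d i ≤ e j ∧ e j ≤ v')) (a : ι) (b : κ) :
    Function.update d i v' a < e b ↔ d a < e b := by
  have := hgap b
  rcases eq_or_ne a i with rfl | ha
  · rw [Function.update_self]
    omega
  · rw [Function.update_of_ne ha]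

theorem raise_face_over_gap_preserves_wins
    {m n : ℕ} (d : Fin m → ℤ) (e : Fin n → ℤ) (i : Fin m) (v' : ℤ)
    (hv : d i ≤ v')
    (hgap : ∀ j : Fin n, ¬ (d i ≤ e j ∧ e j ≤ v')) :
    wins (Function.update d i v') e = wins d e ∧
    wins e (Function.update d i v') = wins e d ∧
    ties (Function.update d i v') e = ties d e ∧
    (Beats (Function.update d i v') e ↔ Beats d e) := by
  have hlt := update_lt_iff_of_gap hv hgap
  have hgt := lt_update_iff_of_gap hv hgap
  have heq (a : Fin m) (b : Fin n) : Function.update d i v' a = e b ↔ d a = e b := by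
    have := hlt a b
    have := hgt a b
    omega
  simp only [Beats, wins, ties, hlt, hgt, heq, and_self]
end

section
/- (Theorem 6.2, 'Multiply by One', '<N<N' form via block replacement.) Let k ≥ 1 and let φ : ℤ × Fin k → ℤ satisfy: for each v, the map t ↦ φ(v, t) is strictly increasing, and for all v < w and all t, t', φ(v, t) < φ(w, t'). For a die d : Fin n → ℤ let d' : Fin n × Fin k → ℤ be defined by d'(i, t) = φ(d i, t). Then for any dice d, e: wins(d', e') = k² · wins(d, e) + (k(k−1)/2) · ties(d, e) and ties(d', e') = k · ties(d, e); consequently d' beats e' if and only if d beats e, and replacing every face of a nontransitive triple of dice by such a strictly increasing block of k faces yields a nontransitive triple. -/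
theorem wins_eq_sum {α β : Type*} [Fintype α] [Fintype β] (d : α → ℤ) (e : β → ℤ) :
    wins d e = ∑ i, ∑ j, if e j < d i then 1 else 0 := by
  rw [wins, Finset.card_filter, Fintype.sum_prod_type]

theorem ties_eq_sum {α β : Type*} [Fintype α] [Fintype β] (d : α → ℤ) (e : β → ℤ) :
    ties d e = ∑ i, ∑ j, if d i = e j then 1 else 0 := by
  rw [ties, Finset.card_filter, Fintype.sum_prod_type]

theorem ties_comm {α β : Type*} [Fintype α] [Fintype β] (d : α → ℤ) (e : β → ℤ) :
    ties d e = ties e d := by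
  rw [ties_eq_sum, ties_eq_sum, Finset.sum_comm]
  simp only [eq_comm]

theorem wins_blocks {α β γ δ : Type*} [Fintype α] [Fintype β] [Fintype γ] [Fintype δ]
    (f : α → γ → ℤ) (g : β → δ → ℤ) :
    wins (fun p : α × γ => f p.1 p.2) (fun p : β × δ => g p.1 p.2)
      = ∑ i, ∑ j, wins (f i) (g j) := by
  simp only [wins_eq_sum, Fintype.sum_prod_type]
  exact Finset.sum_congr rfl fun i _ => Finset.sum_comm

theorem ties_blocks {α β γ δ : Type*} [Fintype α] [Fintype β] [Fintype γ] [Fintype δ]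
    (f : α → γ → ℤ) (g : β → δ → ℤ) :
    ties (fun p : α × γ => f p.1 p.2) (fun p : β × δ => g p.1 p.2)
      = ∑ i, ∑ j, ties (f i) (g j) := by
  simp only [ties_eq_sum, Fintype.sum_prod_type]
  exact Finset.sum_congr rfl fun i _ => Finset.sum_comm

theorem wins_self_of_strictMono {k : ℕ} {f : Fin k → ℤ} (hf : StrictMono f) :
    wins f f = k * (k - 1) / 2 := by
  simp only [wins_eq_sum, hf.lt_iff_lt, ← Finset.card_filter, Finset.filter_gt_eq_Iio, Fin.card_Iio]
  rw [Fin.sum_univ_eq_sum_range (fun i => i), Finset.sum_range_id]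

theorem ties_self_of_injective {k : ℕ} {f : Fin k → ℤ} (hf : Function.Injective f) :
    ties f f = k := by
  simp [ties_eq_sum, hf.eq_iff]

section Blocks

variable {k : ℕ} {φ : ℤ × Fin k → ℤ}

theorem wins_block (hmono : ∀ v : ℤ, StrictMono (fun t : Fin k => φ (v, t)))
    (hsep : ∀ v w : ℤ, v < w → ∀ t t' : Fin k, φ (v, t) < φ (w, t')) (v w : ℤ) :
    wins (fun t => φ (v, t)) (fun t => φ (w, t))
      = k ^ 2 * (if w < v then 1 else 0) + k * (k - 1) / 2 * (if v = w then 1 else 0) := by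
  rcases lt_trichotomy v w with h | rfl | h
  · simp [wins_eq_sum, h.not_gt, h.ne, (hsep v w h _ _).not_gt]
  · simp [wins_self_of_strictMono (hmono v)]
  · simp [wins_eq_sum, h, h.ne', hsep w v h, sq]

theorem ties_block (hmono : ∀ v : ℤ, StrictMono (fun t : Fin k => φ (v, t)))
    (hsep : ∀ v w : ℤ, v < w → ∀ t t' : Fin k, φ (v, t) < φ (w, t')) (v w : ℤ) :
    ties (fun t => φ (v, t)) (fun t => φ (w, t)) = k * (if v = w then 1 else 0) := by
  rcases lt_trichotomy v w with h | rfl | h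
  · simp [ties_eq_sum, h.ne, (hsep v w h _ _).ne]
  · simp [ties_self_of_injective (hmono v).injective]
  · simp [ties_eq_sum, h.ne', (hsep w v h _ _).ne']

variable {α β : Type*} [Fintype α] [Fintype β]

theorem wins_replace_blocks (hmono : ∀ v : ℤ, StrictMono (fun t : Fin k => φ (v, t)))
    (hsep : ∀ v w : ℤ, v < w → ∀ t t' : Fin k, φ (v, t) < φ (w, t')) (d : α → ℤ) (e : β → ℤ) :
    wins (fun p : α × Fin k => φ (d p.1, p.2)) (fun p : β × Fin k => φ (e p.1, p.2))
      = k ^ 2 * wins d e + k * (k - 1) / 2 * ties d e := by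
  rw [wins_blocks (fun i t => φ (d i, t)) (fun j t => φ (e j, t)), wins_eq_sum d e, ties_eq_sum d e]
  simp only [wins_block hmono hsep, Finset.sum_add_distrib, Finset.mul_sum]

theorem ties_replace_blocks (hmono : ∀ v : ℤ, StrictMono (fun t : Fin k => φ (v, t)))
    (hsep : ∀ v w : ℤ, v < w → ∀ t t' : Fin k, φ (v, t) < φ (w, t')) (d : α → ℤ) (e : β → ℤ) :
    ties (fun p : α × Fin k => φ (d p.1, p.2)) (fun p : β × Fin k => φ (e p.1, p.2))
      = k * ties d e := by
  rw [ties_blocks (fun i t => φ (d i, t)) (fun j t => φ (e j, t)), ties_eq_sum d e]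
  simp only [ties_block hmono hsep, Finset.mul_sum]

theorem beats_replace_blocks (hk : 1 ≤ k)
    (hmono : ∀ v : ℤ, StrictMono (fun t : Fin k => φ (v, t)))
    (hsep : ∀ v w : ℤ, v < w → ∀ t t' : Fin k, φ (v, t) < φ (w, t')) (d : α → ℤ) (e : β → ℤ) :
    Beats (fun p : α × Fin k => φ (d p.1, p.2)) (fun p : β × Fin k => φ (e p.1, p.2))
      ↔ Beats d e := by
  rw [Beats, Beats, wins_replace_blocks hmono hsep, wins_replace_blocks hmono hsep, ties_comm e d,
    add_lt_add_iff_right, Nat.mul_lt_mul_left (by positivity)]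

end Blocks

/-- Theorem 6.2, "Multiply by One", "<N<N" form via block replacement. -/
theorem multiply_by_one_lt_form
    {k : ℕ} (hk : 1 ≤ k) (φ : ℤ × Fin k → ℤ)
    (hmono : ∀ v : ℤ, StrictMono (fun t : Fin k => φ (v, t)))
    (hsep : ∀ v w : ℤ, v < w → ∀ t t' : Fin k, φ (v, t) < φ (w, t')) :
    (∀ {m n : ℕ} (d : Fin m → ℤ) (e : Fin n → ℤ),
      wins (fun p : Fin m × Fin k => φ (d p.1, p.2))
          (fun p : Fin n × Fin k => φ (e p.1, p.2))
        = k ^ 2 * wins d e + (k * (k - 1) / 2) * ties d e ∧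
      ties (fun p : Fin m × Fin k => φ (d p.1, p.2))
          (fun p : Fin n × Fin k => φ (e p.1, p.2))
        = k * ties d e ∧
      (Beats (fun p : Fin m × Fin k => φ (d p.1, p.2))
          (fun p : Fin n × Fin k => φ (e p.1, p.2)) ↔ Beats d e)) ∧
    (∀ {n : ℕ} (A B C : Fin n → ℤ), Nontransitive A B C →
      Nontransitive (fun p : Fin n × Fin k => φ (A p.1, p.2))
        (fun p : Fin n × Fin k => φ (B p.1, p.2))
        (fun p : Fin n × Fin k => φ (C p.1, p.2))) := by
  have hbeats {m n : ℕ} (d : Fin m → ℤ) (e : Fin n → ℤ) := beats_replace_blocks hk hmono hsep d e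
  exact ⟨fun d e => ⟨wins_replace_blocks hmono hsep d e, ties_replace_blocks hmono hsep d e,
    hbeats d e⟩, fun A B C ⟨hAB, hBC, hCA⟩ =>
      ⟨(hbeats A B).2 hAB, (hbeats B C).2 hBC, (hbeats C A).2 hCA⟩⟩
end

section
/- Let d₁, e₁ : Fin s → ℤ and d₂, e₂ : Fin t → ℤ be dice such that every face value of d₂ and of e₂ is strictly greater than every face value of d₁ and of e₁. Let d = d₁ ⊕ d₂ and e = e₁ ⊕ e₂ be the (s+t)-sided concatenated dice. Then wins(d, e) = wins(d₁, e₁) + wins(d₂, e₂) + s·t and wins(e, d) = wins(e₁, d₁) + wins(e₂, d₂) + s·t. -/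
theorem wins_append {s t u v : ℕ} (d₁ : Fin s → ℤ) (d₂ : Fin t → ℤ)
    (e₁ : Fin u → ℤ) (e₂ : Fin v → ℤ) :
    wins (Fin.append d₁ d₂) (Fin.append e₁ e₂)
      = wins d₁ e₁ + wins d₁ e₂ + (wins d₂ e₁ + wins d₂ e₂) := by
  simp only [wins_eq_sum, Fin.sum_univ_add, Fin.append_left, Fin.append_right,
    Finset.sum_add_distrib]
  ring

theorem wins_eq_zero {α β : Type*} [Fintype α] [Fintype β] {d : α → ℤ} {e : β → ℤ}
    (h : ∀ i j, d i < e j) : wins d e = 0 := by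
  simp [wins_eq_sum, fun i j => (h i j).not_gt]

theorem wins_eq_card_mul_card {α β : Type*} [Fintype α] [Fintype β] {d : α → ℤ} {e : β → ℤ}
    (h : ∀ i j, e j < d i) : wins d e = Fintype.card α * Fintype.card β := by
  simp [wins_eq_sum, h]

theorem concat_wins
    {s t : ℕ} (d₁ e₁ : Fin s → ℤ) (d₂ e₂ : Fin t → ℤ)
    (h : ∀ (i : Fin s) (j : Fin t),
      d₁ i < d₂ j ∧ d₁ i < e₂ j ∧ e₁ i < d₂ j ∧ e₁ i < e₂ j) :
    wins (Fin.append d₁ d₂) (Fin.append e₁ e₂)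
        = wins d₁ e₁ + wins d₂ e₂ + s * t ∧
    wins (Fin.append e₁ e₂) (Fin.append d₁ d₂)
        = wins e₁ d₁ + wins e₂ d₂ + s * t := by
  constructor
  · rw [wins_append, wins_eq_zero fun i j => (h i j).2.1,
      wins_eq_card_mul_card fun j i => (h i j).2.2.1, Fintype.card_fin, Fintype.card_fin]
    ring
  · rw [wins_append, wins_eq_zero fun i j => (h i j).2.2.1,
      wins_eq_card_mul_card fun j i => (h i j).2.1, Fintype.card_fin, Fintype.card_fin]
    ring
end

section
/- (Theorem 6.3, 'Identity Addition', iterated.) Let k ≥ 1 and for each r ∈ Fin k let (Aᵣ, Bᵣ, Cᵣ) be a nontransitive triple of sᵣ-sided dice with the win chain A beats B, B beats C, C beats A, such that for r < r' every face value appearing in the triple indexed r' is strictly greater than every face value appearing in the triple indexed r. Then the triple of (s₀ + ⋯ + s_{k−1})-sided dice obtained by concatenating the A-dice, the B-dice, and the C-dice respectively in order of r is nontransitive with the same win chain. -/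
theorem wins_sigma {ι κ : Type*} [Fintype ι] [Fintype κ] {α : ι → Type*} {β : κ → Type*}
    [∀ r, Fintype (α r)] [∀ r, Fintype (β r)]
    (d : (r : ι) → α r → ℤ) (e : (r : κ) → β r → ℤ) :
    wins (fun p : Σ r, α r => d p.1 p.2) (fun p : Σ r, β r => e p.1 p.2) =
      ∑ r, ∑ r', wins (d r) (e r') := by
  simp only [wins_eq_sum, Fintype.sum_sigma]
  exact Finset.sum_congr rfl fun r _ => Finset.sum_comm

/-- Concatenating dice over separated blocks of values preserves a win in every block: pairs of
faces from different blocks contribute equally to both sides. -/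
theorem Beats.sigma {ι : Type*} [Fintype ι] [LinearOrder ι] [Nonempty ι] {α : ι → Type*}
    [∀ r, Fintype (α r)] {d e : (r : ι) → α r → ℤ} (h : ∀ r, Beats (d r) (e r))
    (hde : ∀ r r', r < r' → ∀ i j, d r i < e r' j)
    (hed : ∀ r r', r < r' → ∀ i j, e r i < d r' j) :
    Beats (fun p : Σ r, α r => d p.1 p.2) (fun p : Σ r, α r => e p.1 p.2) := by
  have off_diag : ∀ r r', r ≠ r' → wins (e r) (d r') = wins (d r) (e r') := by
    intro r r' hne
    rcases hne.lt_or_gt with hlt | hgt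
    · rw [wins_eq_zero (hed r r' hlt), wins_eq_zero (hde r r' hlt)]
    · rw [wins_eq_card_mul_card fun i j => hde r' r hgt j i,
        wins_eq_card_mul_card fun i j => hed r' r hgt j i]
  have le : ∀ r r', wins (e r) (d r') ≤ wins (d r) (e r') := by
    intro r r'
    rcases eq_or_ne r r' with rfl | hne
    · exact (h r).le
    · exact (off_diag r r' hne).le
  rw [Beats, wins_sigma, wins_sigma]
  exact Finset.sum_lt_sum_of_nonempty Finset.univ_nonempty fun r _ =>
    Finset.sum_lt_sum (fun r' _ => le r r') ⟨r, Finset.mem_univ r, h r⟩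

/-- Theorem 6.3, "Identity Addition", iterated: the dice are concatenated by
indexing the faces by the disjoint union `Σ r : Fin k, Fin (s r)`. -/
theorem identity_addition_iterated
    {k : ℕ} (hk : 1 ≤ k) (s : Fin k → ℕ)
    (A B C : (r : Fin k) → Fin (s r) → ℤ)
    (h : ∀ r : Fin k, Nontransitive (A r) (B r) (C r))
    (hsep : ∀ r r' : Fin k, r < r' →
      ∀ (i : Fin (s r)) (j : Fin (s r')),
        (A r i < A r' j ∧ A r i < B r' j ∧ A r i < C r' j) ∧
        (B r i < A r' j ∧ B r i < B r' j ∧ B r i < C r' j) ∧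
        (C r i < A r' j ∧ C r i < B r' j ∧ C r i < C r' j)) :
    Nontransitive (fun p : Σ r : Fin k, Fin (s r) => A p.1 p.2)
      (fun p : Σ r : Fin k, Fin (s r) => B p.1 p.2)
      (fun p : Σ r : Fin k, Fin (s r) => C p.1 p.2) := by
  have : Nonempty (Fin k) := ⟨⟨0, hk⟩⟩
  exact ⟨Beats.sigma (fun r => (h r).1)
      (fun r r' hr i j => (hsep r r' hr i j).1.2.1)
      (fun r r' hr i j => (hsep r r' hr i j).2.1.1),
    Beats.sigma (fun r => (h r).2.1)
      (fun r r' hr i j => (hsep r r' hr i j).2.1.2.2)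
      (fun r r' hr i j => (hsep r r' hr i j).2.2.2.1),
    Beats.sigma (fun r => (h r).2.2)
      (fun r r' hr i j => (hsep r r' hr i j).2.2.1)
      (fun r r' hr i j => (hsep r r' hr i j).1.2.2)⟩
end

section
/- Let M > 0, let a, b : Fin s → ℤ be dice, and let p, q : Fin m → ℤ be dice with 0 ≤ p j < M and 0 ≤ q j < M for all j. Define the nested dice A, B : Fin s × Fin m → ℤ by A(i, j) = M · (a i) + p j and B(i, j) = M · (b i) + q j. Then wins(A, B) = m² · wins(a, b) + ties(a, b) · wins(p, q) and ties(A, B) = ties(a, b) · ties(p, q). -/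
/-- Comparing two-digit numbers in base `M` is comparing their digits lexicographically. -/
theorem mul_add_lt_mul_add_iff_lex {M x y r t : ℤ}
    (hr : 0 ≤ r ∧ r < M) (ht : 0 ≤ t ∧ t < M) :
    M * y + t < M * x + r ↔ y < x ∨ x = y ∧ t < r := by
  have hM : 0 < M := hr.1.trans_lt hr.2
  rcases lt_trichotomy y x with h | rfl | h
  · have : M * (y + 1) ≤ M * x := mul_le_mul_of_nonneg_left h hM.le
    exact iff_of_true (by linarith [hr.1, ht.2]) (Or.inl h)
  · simp
  · have : M * (x + 1) ≤ M * y := mul_le_mul_of_nonneg_left h hM.le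
    exact iff_of_false (by linarith [hr.2, ht.1]) (by omega)

/-- A two-digit number in base `M` determines its digits. -/
theorem mul_add_eq_mul_add_iff_digits {M x y r t : ℤ}
    (hr : 0 ≤ r ∧ r < M) (ht : 0 ≤ t ∧ t < M) :
    M * x + r = M * y + t ↔ x = y ∧ r = t := by
  have h₁ := mul_add_lt_mul_add_iff_lex (x := x) (y := y) hr ht
  have h₂ := mul_add_lt_mul_add_iff_lex (x := y) (y := x) ht hr
  omega

theorem nested_dice_wins_ties
    {s m : ℕ} (M : ℤ) (hM : 0 < M)
    (a b : Fin s → ℤ) (p q : Fin m → ℤ)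
    (hp : ∀ j, 0 ≤ p j ∧ p j < M) (hq : ∀ j, 0 ≤ q j ∧ q j < M) :
    wins (fun x : Fin s × Fin m => M * a x.1 + p x.2)
        (fun x : Fin s × Fin m => M * b x.1 + q x.2)
      = m ^ 2 * wins a b + ties a b * wins p q ∧
    ties (fun x : Fin s × Fin m => M * a x.1 + p x.2)
        (fun x : Fin s × Fin m => M * b x.1 + q x.2)
      = ties a b * ties p q := by
  let φ := Equiv.prodProdProdComm (Fin s) (Fin m) (Fin s) (Fin m)
  constructor
  · have hdisj : Disjoint
        ((Finset.univ.filter fun x : Fin s × Fin s => b x.2 < a x.1) ×ˢ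
          (Finset.univ : Finset (Fin m × Fin m)))
        ((Finset.univ.filter fun x : Fin s × Fin s => a x.1 = b x.2) ×ˢ
          Finset.univ.filter fun x : Fin m × Fin m => q x.2 < p x.1) :=
      Finset.disjoint_product.mpr <| Or.inl <| Finset.disjoint_filter.mpr
        fun _ _ hlt heq => hlt.ne' heq
    have hcard := Finset.card_disjUnion _ _ hdisj
    simp only [Finset.card_product, Finset.card_univ, Fintype.card_prod, Fintype.card_fin] at hcard
    rw [wins, wins, ties, wins, pow_two, mul_comm (m * m), ← hcard]
    refine Finset.card_equiv φ fun x => ?_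
    simp [φ, mul_add_lt_mul_add_iff_lex (hp _) (hq _)]
  · rw [ties, ties, ties, ← Finset.card_product]
    refine Finset.card_equiv φ fun x => ?_
    simp [φ, mul_add_eq_mul_add_iff_digits (hp _) (hq _)]
end

section
/- (Theorem 6.4b, 'Identity Dice Multiplication'.) Let M > 0. Let (a₀, a₁, a₂) be a nontransitive triple of s-sided dice (a₀ beats a₁, a₁ beats a₂, a₂ beats a₀) such that ties(a_X, a_Y) = 0 for all distinct X, Y. For each X ∈ Fin 3 let (p_{X,0}, p_{X,1}, p_{X,2}) be a nontransitive triple of m-sided dice (p_{X,0} beats p_{X,1}, p_{X,1} beats p_{X,2}, p_{X,2} beats p_{X,0}) with all face values in [0, M). Define nine dice D(X, u) : Fin s × Fin m → ℤ by D(X, u)(i, j) = M·(a_X i) + p_{X,u} j. Then: (1) for distinct X, Y, if a_X beats a_Y then D(X, u) beats D(Y, v) for all u, v; (2) for each X and distinct u, v, D(X, u) beats D(X, v) if and only if p_{X,u} beats p_{X,v}. In particular each of the nine dice beats exactly four of the other eight and is beaten by exactly four, so the nine dice form a perfectly nontransitive set. -/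
/-- When all values of `p` and `q` lie in `[0, M)`, the sides `M * a i + p j` and `M * b i + q j`
are compared lexicographically, with ties on the first coordinate broken by the second. -/
theorem wins_mul_add {α β γ δ : Type*} [Fintype α] [Fintype β] [Fintype γ] [Fintype δ] {M : ℤ}
    (a : α → ℤ) (b : β → ℤ) (p : γ → ℤ) (q : δ → ℤ)
    (hp : ∀ j, 0 ≤ p j ∧ p j < M) (hq : ∀ j, 0 ≤ q j ∧ q j < M) :
    wins (fun x : α × γ => M * a x.1 + p x.2) (fun x : β × δ => M * b x.1 + q x.2) =
      wins a b * (Fintype.card γ * Fintype.card δ) + ties a b * wins p q := by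
  have key : ∀ (i : α) (k : β) (j : γ) (l : δ),
      (if M * b k + q l < M * a i + p j then 1 else 0 : ℕ) =
        (if b k < a i then 1 else 0) * 1 +
          (if a i = b k then 1 else 0) * (if q l < p j then 1 else 0) := by
    intro i k j l
    obtain ⟨hp0, hpM⟩ := hp j
    obtain ⟨hq0, hqM⟩ := hq l
    rcases lt_trichotomy (a i) (b k) with h | h | h
    · have : ¬ M * b k + q l < M * a i + p j := by nlinarith
      simp [this, h.not_gt, h.ne]
    · simp [h]
    · have : M * b k + q l < M * a i + p j := by nlinarith
      simp [this, h, h.ne']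
  have hcard : Fintype.card γ * Fintype.card δ = ∑ _y : γ × δ, 1 := by simp
  unfold wins ties
  simp only [Finset.card_filter]
  rw [hcard, Fintype.sum_mul_sum, Fintype.sum_mul_sum, ← Fintype.sum_prod_type',
    ← Fintype.sum_prod_type', ← Finset.sum_add_distrib]
  exact Fintype.sum_equiv (Equiv.prodProdProdComm α γ β δ) _ _ fun x => key _ _ _ _

theorem wins_eq_zero_of_isEmpty {α β : Type*} [Fintype α] [Fintype β] [IsEmpty α]
    (d : α → ℤ) (e : β → ℤ) : wins d e = 0 := by
  simp [wins]

theorem Beats.nonempty {α β : Type*} [Fintype α] [Fintype β] {d : α → ℤ} {e : β → ℤ}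
    (h : Beats d e) : Nonempty α := by
  by_contra hα
  rw [not_nonempty_iff] at hα
  simp [Beats, wins_eq_zero_of_isEmpty d e] at h

theorem ties_self_pos {α : Type*} [Fintype α] [Nonempty α] (d : α → ℤ) : 0 < ties d d := by
  obtain ⟨i⟩ := ‹Nonempty α›
  exact Finset.card_pos.mpr ⟨(i, i), by simp⟩

/-- In a nontransitive triple, each die beats exactly its cyclic successor. -/
theorem Nontransitive.beats_iff {α : Type*} [Fintype α] {f : Fin 3 → α → ℤ}
    (h : Nontransitive (f 0) (f 1) (f 2)) (X Y : Fin 3) : Beats (f X) (f Y) ↔ Y = X + 1 := by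
  obtain ⟨h₀, h₁, h₂⟩ := h
  unfold Beats at *
  fin_cases X <;> fin_cases Y <;> simp <;> omega

/-- Theorem 6.4b, "Identity Dice Multiplication". -/
theorem identity_dice_multiplication
    {s m : ℕ} (M : ℤ) (hM : 0 < M)
    (a : Fin 3 → Fin s → ℤ)
    (ha : Nontransitive (a 0) (a 1) (a 2))
    (haties : ∀ X Y : Fin 3, X ≠ Y → ties (a X) (a Y) = 0)
    (p : Fin 3 → Fin 3 → Fin m → ℤ)
    (hp : ∀ X : Fin 3, Nontransitive (p X 0) (p X 1) (p X 2))
    (hrange : ∀ (X u : Fin 3) (j : Fin m), 0 ≤ p X u j ∧ p X u j < M)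
    (D : Fin 3 → Fin 3 → Fin s × Fin m → ℤ)
    (hD : ∀ X u, D X u = fun x : Fin s × Fin m => M * a X x.1 + p X u x.2) :
    (∀ X Y : Fin 3, X ≠ Y → Beats (a X) (a Y) →
      ∀ u v : Fin 3, Beats (D X u) (D Y v)) ∧
    (∀ X : Fin 3, ∀ u v : Fin 3, u ≠ v →
      (Beats (D X u) (D X v) ↔ Beats (p X u) (p X v))) ∧
    (∀ X u : Fin 3,
      ((Finset.univ : Finset (Fin 3 × Fin 3)).filter
        (fun Yv => Beats (D X u) (D Yv.1 Yv.2))).card = 4 ∧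
      ((Finset.univ : Finset (Fin 3 × Fin 3)).filter
        (fun Yv => Beats (D Yv.1 Yv.2) (D X u))).card = 4) := by
  have : Nonempty (Fin s) := ha.1.nonempty
  have : Nonempty (Fin m) := (hp 0).1.nonempty
  have hwins (X Y u v : Fin 3) : wins (D X u) (D Y v) =
      wins (a X) (a Y) * (m * m) + ties (a X) (a Y) * wins (p X u) (p Y v) := by
    rw [hD, hD, wins_mul_add _ _ _ _ (hrange X u) (hrange Y v), Fintype.card_fin]
  have hm : 0 < m * m := by
    have : 0 < m := Fin.pos_iff_nonempty.mpr inferInstance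
    positivity
  have hne (X Y : Fin 3) (hXY : X ≠ Y) (u v : Fin 3) :
      Beats (D X u) (D Y v) ↔ Beats (a X) (a Y) := by
    unfold Beats
    rw [hwins, hwins, haties X Y hXY, haties Y X hXY.symm, zero_mul, zero_mul, add_zero, add_zero,
      Nat.mul_lt_mul_right hm]
  have heq (X u v : Fin 3) : Beats (D X u) (D X v) ↔ Beats (p X u) (p X v) := by
    unfold Beats
    rw [hwins, hwins, Nat.add_lt_add_iff_left, Nat.mul_lt_mul_left (ties_self_pos (a X))]
  have hbeats (X u Y v : Fin 3) :
      Beats (D X u) (D Y v) ↔ Y = X + 1 ∨ X = Y ∧ v = u + 1 := by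
    by_cases hXY : X = Y
    · subst hXY
      simp [heq, (hp X).beats_iff]
    · simp [hne X Y hXY, ha.beats_iff, hXY]
  refine ⟨fun X Y hXY h u v => (hne X Y hXY u v).mpr h, fun X u v _ => heq X u v, ?_⟩
  simp only [hbeats]
  decide
end

section
/- (Remark 10.1.) Define the tournament relation r on Fin 3 × Fin 3 by: (X, u) r (Y, v) holds if and only if (Y − X) mod 3 = 1, or X = Y and (v − u) mod 3 = 1 (this is the beats relation of the nine dice produced by Identity Dice Multiplication of two 3-dice nontransitive identities). Then there is no 5-element subset S of Fin 3 × Fin 3 such that every element of S is related by r to exactly two other elements of S; that is, no pattern of removing four of the nine dice yields a perfectly nontransitive set of five dice. -/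
/-- Remark 10.1: in the 9-dice tournament produced by Identity Dice
Multiplication of two 3-dice nontransitive identities, no 5-element subset of
the nine dice is such that each of its members beats exactly two of the other
four; i.e. no removal of four dice leaves a perfectly nontransitive 5-dice set. -/
theorem no_regular_five_subset_of_nine_dice_tournament
    (r : Fin 3 × Fin 3 → Fin 3 × Fin 3 → Prop)
    (hr : ∀ x y : Fin 3 × Fin 3,
      r x y ↔ (y.1 - x.1 = 1 ∨ (x.1 = y.1 ∧ y.2 - x.2 = 1)))
    [DecidableRel r] :
    ¬ ∃ S : Finset (Fin 3 × Fin 3), S.card = 5 ∧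
      ∀ x ∈ S, (S.filter (fun y => y ≠ x ∧ r x y)).card = 2 := by
  rintro ⟨S, hS, hreg⟩
  have key : ∀ T : Finset (Fin 3 × Fin 3), T.card = 5 →
      ¬ ∀ x ∈ T, (T.filter (fun y => y ≠ x ∧
        (y.1 - x.1 = 1 ∨ (x.1 = y.1 ∧ y.2 - x.2 = 1)))).card = 2 := by
    decide +kernel
  refine key S hS fun x hx => ?_
  simpa only [hr] using hreg x hx
end
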